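/- arXiv:1903.00209 — 2 statements merged into one kernel-verified Lean document; each statement's English description precedes it below -/
import Mathlib

section
/- Let n ≥ 4, p ≥ 1, let H_1,…,H_p be real symmetric n×n matrices, c a real number, and let q be an integer with 2 ≤ q ≤ n/2. Let e_1,…,e_n be an orthonormal basis of ℝⁿ. If (n−q)(q−1)·R + (n−2q)·Σ_{i=1}^q Ric(e_i) > n²(n−q−1)(q−1)(c+H²), then Σ_{k=q+1}^n Σ_{i=1}^q [2‖h(e_i,e_k)‖² − ⟨h(e_i,e_i), h(e_k,e_k)⟩] < q(n−q)c. -/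
open Matrix BigOperators

noncomputable section

/-- Squared mean curvature `H² = Σ_α (tr H_α / n)²`. -/
def meanCurvSq (n p : ℕ) (Hm : Fin p → Matrix (Fin n) (Fin n) ℝ) : ℝ :=
  ∑ α, ((Hm α).trace / n) ^ 2

/-- `S = Σ_α ‖H_α‖²` (squared Frobenius norm of the second fundamental form). -/
def sqNormSff (n p : ℕ) (Hm : Fin p → Matrix (Fin n) (Fin n) ℝ) : ℝ :=
  ∑ α, ∑ i, ∑ j, (Hm α i j) ^ 2

/-- Scalar curvature `R = n(n−1)c + n²H² − S`. -/
def scalarCurv (n p : ℕ) (Hm : Fin p → Matrix (Fin n) (Fin n) ℝ) (c : ℝ) : ℝ :=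
  n * (n - 1) * c + n ^ 2 * meanCurvSq n p Hm - sqNormSff n p Hm

/-- Ricci curvature of a unit vector `u`, via the Gauss equation:
`Ric(u) = (n−1)c + Σ_α (tr(H_α)⟨H_α u,u⟩ − ‖H_α u‖²)`. -/
def ricci (n p : ℕ) (Hm : Fin p → Matrix (Fin n) (Fin n) ℝ) (c : ℝ) (u : Fin n → ℝ) : ℝ :=
  (n - 1) * c + ∑ α, ((Hm α).trace * ((Hm α).mulVec u ⬝ᵥ u)
    - (Hm α).mulVec u ⬝ᵥ (Hm α).mulVec u)

/-- Second fundamental form `h(u,v) = (⟨H_1 u,v⟩,…,⟨H_p u,v⟩) ∈ ℝ^p`. -/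
def sff (n p : ℕ) (Hm : Fin p → Matrix (Fin n) (Fin n) ℝ) (u v : Fin n → ℝ) : Fin p → ℝ :=
  fun α => (Hm α).mulVec u ⬝ᵥ v

/-- Euclidean inner product `⟨h(u,v), h(w,z)⟩` in `ℝ^p`. -/
def sffInner (n p : ℕ) (Hm : Fin p → Matrix (Fin n) (Fin n) ℝ) (u v w z : Fin n → ℝ) : ℝ :=
  ∑ α, sff n p Hm u v α * sff n p Hm w z α

open Finset in
/-- The block estimate for a symmetric matrix behind the Lawson–Simons condition: the diagonal
blocks are bounded below by their traces through the Cauchy–Schwarz inequality. -/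
theorem block_estimate {ι : Type*} [Fintype ι] [DecidableEq ι] (M : Matrix ι ι ℝ)
    (hM : M.IsSymm) (s : Finset ι) (q m : ℝ) (hs : (#s : ℝ) = q) (hsc : (#sᶜ : ℝ) = m)
    (hq : 2 ≤ q) (hqm : q ≤ m) :
    (q - 1) * M.trace ^ 2 - m * (q - 1) * ∑ i, ∑ j, M i j ^ 2
        + (m - q) * ∑ i ∈ s, (M.trace * M i i - ∑ j, M i j ^ 2)
      ≤ -(m + q - 2) * ∑ k ∈ sᶜ, ∑ i ∈ s, (2 * M i k ^ 2 - M i i * M k k) := by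
  have diag_sq_le (u : Finset ι) :
      (∑ i ∈ u, M i i) ^ 2 ≤ #u * ∑ i ∈ u, ∑ j ∈ u, M i j ^ 2 := by
    refine sq_sum_le_card_mul_sum_sq.trans (mul_le_mul_of_nonneg_left ?_ (Nat.cast_nonneg _))
    exact sum_le_sum fun i hi =>
      single_le_sum (f := fun j => M i j ^ 2) (fun j _ => sq_nonneg _) hi
  have h₁ := diag_sq_le s
  have h₂ := diag_sq_le sᶜ
  rw [hs] at h₁
  rw [hsc] at h₂
  have htr : M.trace = ∑ i ∈ s, M i i + ∑ i ∈ sᶜ, M i i := (sum_add_sum_compl s _).symm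
  have hrow (u : Finset ι) : ∑ i ∈ u, ∑ j, M i j ^ 2
      = ∑ i ∈ u, ∑ j ∈ s, M i j ^ 2 + ∑ i ∈ u, ∑ j ∈ sᶜ, M i j ^ 2 := by
    rw [← sum_add_distrib]
    exact sum_congr rfl fun i _ => (sum_add_sum_compl s _).symm
  have hoff : ∑ i ∈ sᶜ, ∑ j ∈ s, M i j ^ 2 = ∑ i ∈ s, ∑ j ∈ sᶜ, M i j ^ 2 := by
    rw [sum_comm]
    exact sum_congr rfl fun i _ => sum_congr rfl fun j _ => by rw [hM.apply i j]
  have hall : ∑ i, ∑ j, M i j ^ 2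
      = ∑ i ∈ s, ∑ j, M i j ^ 2 + ∑ i ∈ sᶜ, ∑ j, M i j ^ 2 := (sum_add_sum_compl s _).symm
  have hmix : ∑ k ∈ sᶜ, ∑ i ∈ s, (2 * M i k ^ 2 - M i i * M k k)
      = 2 * ∑ i ∈ s, ∑ j ∈ sᶜ, M i j ^ 2 - (∑ i ∈ s, M i i) * ∑ i ∈ sᶜ, M i i := by
    rw [sum_comm, mul_sum, sum_mul, ← sum_sub_distrib]
    refine sum_congr rfl fun i _ => ?_
    rw [sum_sub_distrib, ← mul_sum, ← mul_sum]
  have hX : 0 ≤ ∑ i ∈ s, ∑ j ∈ sᶜ, M i j ^ 2 :=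
    sum_nonneg fun i _ => sum_nonneg fun j _ => sq_nonneg _
  rw [hmix, hall, sum_sub_distrib, ← mul_sum, hrow s, hrow sᶜ, hoff, htr]
  generalize ∑ i ∈ s, ∑ j ∈ sᶜ, M i j ^ 2 = X at *
  generalize ∑ i ∈ s, ∑ j ∈ s, M i j ^ 2 = N₁ at *
  generalize ∑ i ∈ sᶜ, ∑ j ∈ sᶜ, M i j ^ 2 = N₂ at *
  generalize ∑ i ∈ s, M i i = A at *
  generalize ∑ i ∈ sᶜ, M i i = B at *
  have hc : 0 ≤ 2 * m * q - 3 * m - 3 * q + 4 := by nlinarith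
  have hm : 0 ≤ m - 1 := by linarith
  have hq₁ : 0 ≤ q - 1 := by linarith
  linear_combination (m - 1) * h₁ + (q - 1) * h₂ + X * hc

/-- The sum of the squared entries of a matrix is the trace of its Gram matrix. -/
theorem sum_sq_eq_trace {ι : Type*} [Fintype ι] (A : Matrix ι ι ℝ) :
    ∑ i, ∑ j, A i j ^ 2 = (A * Aᵀ).trace := by
  simp [Matrix.trace, Matrix.mul_apply, sq]

/-- The matrix `(⟨H e_i, e_j⟩)` of `H` with respect to the family `e`. -/
def frameMatrix {ι : Type*} [Fintype ι] (H : Matrix ι ι ℝ) (e : ι → ι → ℝ) : Matrix ι ι ℝ :=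
  Matrix.of fun i j => H.mulVec (e i) ⬝ᵥ e j

section frameMatrix

variable {ι : Type*} [Fintype ι] (H : Matrix ι ι ℝ) (e : ι → ι → ℝ)

theorem frameMatrix_eq_mul : frameMatrix H e = Matrix.of e * Hᵀ * (Matrix.of e)ᵀ := by
  ext i j
  simp [frameMatrix, Matrix.mul_apply, Matrix.mulVec, dotProduct, mul_comm]

theorem frameMatrix_isSymm (hH : H.IsSymm) : (frameMatrix H e).IsSymm := by
  rw [Matrix.IsSymm, frameMatrix_eq_mul]
  simp [Matrix.transpose_mul, Matrix.mul_assoc, hH.eq]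

variable [DecidableEq ι]

theorem of_transpose_mul_of (he : ∀ i j, e i ⬝ᵥ e j = if i = j then (1 : ℝ) else 0) :
    (Matrix.of e)ᵀ * Matrix.of e = 1 := by
  rw [mul_eq_one_comm]
  ext i j
  simpa [Matrix.mul_apply, dotProduct, Matrix.one_apply] using he i j

theorem trace_frameMatrix (he : ∀ i j, e i ⬝ᵥ e j = if i = j then (1 : ℝ) else 0) :
    (frameMatrix H e).trace = H.trace := by
  rw [frameMatrix_eq_mul, Matrix.trace_mul_comm, ← Matrix.mul_assoc, of_transpose_mul_of e he,
    Matrix.one_mul, Matrix.trace_transpose]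

theorem frameMatrix_mul_transpose
    (he : ∀ i j, e i ⬝ᵥ e j = if i = j then (1 : ℝ) else 0) :
    frameMatrix H e * (frameMatrix H e)ᵀ = Matrix.of e * (Hᵀ * H) * (Matrix.of e)ᵀ := by
  rw [frameMatrix_eq_mul]
  calc _ = Matrix.of e * Hᵀ * ((Matrix.of e)ᵀ * Matrix.of e) * H * (Matrix.of e)ᵀ := by
        simp [Matrix.transpose_mul, Matrix.mul_assoc]
    _ = _ := by rw [of_transpose_mul_of e he]; simp [Matrix.mul_assoc]

theorem sum_sq_frameMatrix (he : ∀ i j, e i ⬝ᵥ e j = if i = j then (1 : ℝ) else 0) :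
    ∑ i, ∑ j, frameMatrix H e i j ^ 2 = ∑ i, ∑ j, H i j ^ 2 := by
  rw [sum_sq_eq_trace, sum_sq_eq_trace, frameMatrix_mul_transpose H e he,
    Matrix.trace_mul_comm, ← Matrix.mul_assoc, of_transpose_mul_of e he, Matrix.one_mul,
    Matrix.trace_mul_comm]

theorem sum_sq_frameMatrix_row (he : ∀ i j, e i ⬝ᵥ e j = if i = j then (1 : ℝ) else 0)
    (i : ι) : ∑ j, frameMatrix H e i j ^ 2 = H.mulVec (e i) ⬝ᵥ H.mulVec (e i) := by
  calc _ = (frameMatrix H e * (frameMatrix H e)ᵀ) i i := by simp [Matrix.mul_apply, sq]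
    _ = (Matrix.of e * Hᵀ * (Matrix.of e * Hᵀ)ᵀ) i i := by
        rw [frameMatrix_mul_transpose H e he]
        simp [Matrix.transpose_mul, Matrix.mul_assoc]
    _ = _ := by
        simp [Matrix.mul_apply, Matrix.mulVec, dotProduct, mul_comm]

end frameMatrix

theorem stmt_9 (n p : ℕ) (hn : 4 ≤ n) (hp : 1 ≤ p)
    (Hm : Fin p → Matrix (Fin n) (Fin n) ℝ) (hsym : ∀ α, (Hm α).IsSymm) (c : ℝ)
    (q : ℕ) (hq : 2 ≤ q) (hq2 : 2 * q ≤ n)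
    (e : Fin n → Fin n → ℝ)
    (he : ∀ i j, e i ⬝ᵥ e j = if i = j then (1 : ℝ) else 0)
    (hpinch : ((n : ℝ) - q) * ((q : ℝ) - 1) * scalarCurv n p Hm c
        + ((n : ℝ) - 2 * q) *
            ∑ i ∈ Finset.univ.filter (fun i : Fin n => (i : ℕ) < q), ricci n p Hm c (e i)
      > (n : ℝ) ^ 2 * ((n : ℝ) - q - 1) * ((q : ℝ) - 1) * (c + meanCurvSq n p Hm)) :
    ∑ k ∈ Finset.univ.filter (fun k : Fin n => q ≤ (k : ℕ)),
        ∑ i ∈ Finset.univ.filter (fun i : Fin n => (i : ℕ) < q),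
          (2 * sffInner n p Hm (e i) (e k) (e i) (e k)
            - sffInner n p Hm (e i) (e i) (e k) (e k))
      < (q : ℝ) * ((n : ℝ) - q) * c := by
  have hn0 : (n : ℝ) ≠ 0 := by simp; omega
  have hq' : (2 : ℝ) ≤ q := by exact_mod_cast hq
  have hqn : 2 * (q : ℝ) ≤ n := by exact_mod_cast hq2
  set s : Finset (Fin n) := Finset.univ.filter (fun i : Fin n => (i : ℕ) < q) with hs
  have hsc : Finset.univ.filter (fun k : Fin n => q ≤ (k : ℕ)) = sᶜ := by
    ext k; simp [hs]
  have hcard : s.card = q := by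
    rw [hs, Fin.card_filter_val_lt]; omega
  have hcard' : (sᶜ.card : ℝ) = n - q := by
    rw [Finset.card_compl, hcard, Fintype.card_fin, Nat.cast_sub (by omega)]
  have hest := Finset.sum_le_sum fun α (_ : α ∈ Finset.univ) =>
    block_estimate (frameMatrix (Hm α) e) (frameMatrix_isSymm _ e (hsym α)) s q (n - q)
      (by rw [hcard]) hcard' hq' (by linarith)
  simp only [trace_frameMatrix _ e he, sum_sq_frameMatrix _ e he] at hest
  simp only [sum_sq_frameMatrix_row _ e he] at hest
  rw [Finset.sum_add_distrib, Finset.sum_sub_distrib, ← Finset.mul_sum, ← Finset.mul_sum,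
    ← Finset.mul_sum, ← Finset.mul_sum] at hest
  have hH : (n : ℝ) ^ 2 * meanCurvSq n p Hm = ∑ α, (Hm α).trace ^ 2 := by
    rw [meanCurvSq, Finset.mul_sum]
    exact Finset.sum_congr rfl fun α _ => by field_simp
  have hric : ∑ i ∈ s, ricci n p Hm c (e i) = q * ((n - 1) * c)
      + ∑ α, ∑ i ∈ s, ((Hm α).trace * frameMatrix (Hm α) e i i
        - (Hm α).mulVec (e i) ⬝ᵥ (Hm α).mulVec (e i)) := by
    simp only [ricci]
    rw [Finset.sum_add_distrib, Finset.sum_const, hcard, nsmul_eq_mul, Finset.sum_comm]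
    rfl
  have hgoal : ∑ k ∈ sᶜ, ∑ i ∈ s, (2 * sffInner n p Hm (e i) (e k) (e i) (e k)
        - sffInner n p Hm (e i) (e i) (e k) (e k))
      = ∑ α, ∑ k ∈ sᶜ, ∑ i ∈ s, (2 * frameMatrix (Hm α) e i k ^ 2
        - frameMatrix (Hm α) e i i * frameMatrix (Hm α) e k k) := by
    refine Eq.trans (Finset.sum_congr rfl fun k _ => ?_) Finset.sum_comm
    refine Eq.trans ?_ Finset.sum_comm
    refine Finset.sum_congr rfl fun i _ => ?_
    simp only [sffInner, Finset.mul_sum, ← Finset.sum_sub_distrib, sq]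
    rfl
  rw [hsc, hgoal]
  rw [hric, scalarCurv, sqNormSff] at hpinch
  refine lt_of_mul_lt_mul_left ?_ (by linarith : (0 : ℝ) ≤ n - 2)
  linear_combination hest + hpinch + ((q : ℝ) - 1) * hH
end
end

section
/- Let n ≥ 4, p ≥ 1, let H_1,…,H_p be real symmetric n×n matrices and c ≥ 0 a real number. Set σ_n = sgn(n−4)·((−1)ⁿ+3), where sgn is the standard sign function. Assume R > n(n−2)(c+H²) and Ric(u) ≥ (n−2−2σ_n/(2n−σ_n))(c+H²) for every unit vector u ∈ ℝⁿ. Then for every integer q with 1 ≤ q ≤ n/2 and every orthonormal basis e_1,…,e_n of ℝⁿ, Σ_{k=q+1}^n Σ_{i=1}^q [2‖h(e_i,e_k)‖² − ⟨h(e_i,e_i), h(e_k,e_k)⟩] < q(n−q)c. -/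
open Matrix BigOperators

noncomputable section

open Finset in
/-- Splitting a sum over `Fin n` at `q`. -/
lemma sum_split_lt {n : ℕ} (q : ℕ) (f : Fin n → ℝ) :
    ∑ i, f i = ∑ i ∈ univ.filter (fun i : Fin n => (i : ℕ) < q), f i
      + ∑ i ∈ univ.filter (fun i : Fin n => q ≤ (i : ℕ)), f i := by
  rw [← sum_filter_add_sum_filter_not univ (fun i : Fin n => (i : ℕ) < q) f]
  simp only [not_lt]

open Finset in
/-- The squared trace of a block is at most its size times its squared Frobenius norm. -/
lemma sq_sum_diag_le {ι : Type*} (s : Finset ι) (W : ι → ι → ℝ) :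
    (∑ i ∈ s, W i i) ^ 2 ≤ (#s : ℝ) * ∑ i ∈ s, ∑ j ∈ s, W i j ^ 2 := by
  refine sq_sum_le_card_mul_sum_sq.trans ?_
  gcongr with i hi
  exact single_le_sum (f := fun j => W i j ^ 2) (fun j _ => sq_nonneg _) hi

/-- The scalar inequality behind the nonexistence condition: `Po`, `Qo`, `B` are the squared norms
of the blocks of the traceless second fundamental form, `a` the squared norm of the trace of its
first block and `x` the inner product of that trace with the mean curvature vector. -/
lemma traceless_block_bound {n q K D Po Qo B a x : ℝ} (hn : 4 ≤ n) (hq : q = 1 ∨ 2 ≤ q)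
    (hqn : 2 * q ≤ n) (hK : 0 < K) (ha : 0 ≤ a) (hB : 0 ≤ B) (hPo : a ≤ q * Po)
    (hQo : a ≤ (n - q) * Qo) (hS : Po + Qo + 2 * B < n * K)
    (hRic : Po + B ≤ (n - 2) * x + q * D * K)
    (hD : 2 * q < n → q * D ≤ n - q) (hDone : 2 * D ≤ n - 2) :
    2 * B + a - (n - 2 * q) * x < q * (n - q) * K := by
  have hqpos : 0 < q := by rcases hq with h | h <;> linarith
  have hnq : 0 < n - q := by linarith
  have hn2 : 0 < n - 2 := by linarith
  have key : n * a + 2 * B * (q * (n - q)) < n * K * (q * (n - q)) := by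
    have h1 := mul_lt_mul_of_pos_right hS (mul_pos hqpos hnq)
    have h2 := mul_le_mul_of_nonneg_left hPo hnq.le
    have h3 := mul_le_mul_of_nonneg_left hQo hqpos.le
    nlinarith
  rcases hqn.eq_or_lt with heq | hlt
  · obtain rfl : n = 2 * q := heq.symm
    have h4 : 2 * a + 2 * B * q < 2 * K * q * q := by
      refine lt_of_mul_lt_mul_right ?_ hqpos.le
      linarith
    have h5 : 2 * (2 * B) ≤ q * (2 * B) := by gcongr; linarith
    nlinarith
  rcases hq with rfl | hq2
  · have h1 : a ≤ Po := by linarith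
    have h2 : 0 ≤ Qo := by
      by_contra hneg
      nlinarith [mul_pos hnq (neg_pos.2 (not_le.1 hneg))]
    have h3 := mul_le_mul_of_nonneg_right hDone hK.le
    nlinarith
  · have hm : 0 < n - 2 * q := by linarith
    have h1 := mul_le_mul_of_nonneg_left hRic (mul_pos hqpos hm).le
    have h2 := mul_le_mul_of_nonneg_left hPo hm.le
    have h3 := mul_le_mul_of_nonneg_right (hD hlt) (mul_pos (mul_pos hm hqpos) hK).le
    have h4 : (q - 1) * (n * a + 2 * B * (q * (n - q)))
        < (q - 1) * (n * K * (q * (n - q))) :=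
      mul_lt_mul_of_pos_left key (by linarith)
    have h5 : 0 ≤ q * B * (2 * (q - 1) * (n - q) - (n + 2 * q - 4)) := by
      refine mul_nonneg (mul_nonneg hqpos.le hB) ?_
      nlinarith
    refine lt_of_mul_lt_mul_left ?_ (mul_pos hqpos hn2).le
    nlinarith

/-- The Lawson–Simons inequality in terms of the block quantities `X = Σ T_α A_α`, `Y = Σ A_α²`,
`Z = Σ T_α²`, where `A_α` is the trace of the first `q × q` block of `H_α`. -/
lemma block_bound {n q c D P Q B X Y Z : ℝ} (hn : 4 ≤ n) (hq : q = 1 ∨ 2 ≤ q)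
    (hqn : 2 * q ≤ n) (ha : 0 ≤ Y - 2 * q * X + q ^ 2 * Z) (hB : 0 ≤ B) (hP : Y ≤ q * P)
    (hQ : n ^ 2 * Z - 2 * n * X + Y ≤ (n - q) * Q)
    (hS : n * (n - 1) * c + n ^ 2 * Z - (P + Q + 2 * B) > n * (n - 2) * (c + Z))
    (hRic : q * ((n - 1 - D) * (c + Z)) ≤ q * ((n - 1) * c) + (n * X - (P + B)))
    (hD : 2 * q < n → q * D ≤ n - q) (hDone : 2 * D ≤ n - 2) :
    2 * B - (n * X - Y) < q * (n - q) * c := by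
  have hqpos : 0 < q := by rcases hq with h | h <;> linarith
  have hnq : 0 < n - q := by linarith
  have hPo : Y - 2 * q * X + q ^ 2 * Z ≤ q * (P - 2 * X + q * Z) := by linarith
  have hQo : Y - 2 * q * X + q ^ 2 * Z
      ≤ (n - q) * (Q - 2 * (n * Z - X) + (n - q) * Z) := by linarith
  have hPpos : 0 ≤ P - 2 * X + q * Z := nonneg_of_mul_nonneg_right (ha.trans hPo) hqpos
  have hQpos : 0 ≤ Q - 2 * (n * Z - X) + (n - q) * Z :=
    nonneg_of_mul_nonneg_right (ha.trans hQo) hnq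
  have hSo : (P - 2 * X + q * Z) + (Q - 2 * (n * Z - X) + (n - q) * Z) + 2 * B
      < n * (c + Z) := by linarith
  have hK : 0 < c + Z := pos_of_mul_pos_right (a := n) (by linarith) (by linarith)
  have := traceless_block_bound (x := X - q * Z) (D := D) hn hq hqn hK ha hB hPo hQo hSo
    (by linarith) hD hDone
  linarith

/-- Bounds on the Ricci pinching constant `1 + 2σ / (2n - σ)`. -/
lemma pinching_bounds {n q : ℕ} (hn : 4 ≤ n) (hq : 1 ≤ q) {σ : ℝ}
    (hσ : σ = Real.sign ((n : ℝ) - 4) * ((-1 : ℝ) ^ n + 3)) :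
    (2 * (q : ℝ) < n → q * (1 + 2 * σ / (2 * n - σ)) ≤ n - q)
      ∧ 2 * (1 + 2 * σ / (2 * n - σ)) ≤ (n : ℝ) - 2 := by
  have hq' : (1 : ℝ) ≤ q := by exact_mod_cast hq
  rcases hn.eq_or_lt with rfl | hn5
  · have h0 : σ = 0 := by rw [hσ]; norm_num
    subst h0
    norm_num
    intro h
    linarith
  have hn5' : (5 : ℝ) ≤ n := by exact_mod_cast hn5
  rw [Real.sign_of_pos (by linarith), one_mul] at hσ
  rcases Nat.even_or_odd n with he | ho
  · rw [he.neg_one_pow] at hσ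
    have hn6 : (6 : ℝ) ≤ n := by
      have : 6 ≤ n := by obtain ⟨k, hk⟩ := he; omega
      exact_mod_cast this
    have hpos : (0 : ℝ) < 2 * n - σ := by rw [hσ]; linarith
    have hD : 1 + 2 * σ / (2 * n - σ) = (n + 2) / ((n : ℝ) - 2) := by
      have : (n : ℝ) - 2 ≠ 0 := by linarith
      field_simp
      rw [hσ]; ring
    rw [hD]
    constructor
    · intro h
      have : (2 : ℝ) * q + 2 ≤ n := by
        have h' : 2 * q < n := by exact_mod_cast h
        have : 2 * q + 2 ≤ n := by obtain ⟨k, hk⟩ := he; omega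
        exact_mod_cast this
      rw [← mul_div_assoc, div_le_iff₀ (by linarith)]
      nlinarith
    · rw [← mul_div_assoc, div_le_iff₀ (by linarith)]
      nlinarith
  · rw [ho.neg_one_pow] at hσ
    have hpos : (0 : ℝ) < 2 * n - σ := by rw [hσ]; linarith
    have hD : 1 + 2 * σ / (2 * n - σ) = (n + 1) / ((n : ℝ) - 1) := by
      have : (n : ℝ) - 1 ≠ 0 := by linarith
      field_simp
      rw [hσ]; ring
    rw [hD]
    constructor
    · intro h
      have : (2 : ℝ) * q + 1 ≤ n := by
        have h' : 2 * q < n := by exact_mod_cast h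
        exact_mod_cast h'
      rw [← mul_div_assoc, div_le_iff₀ (by linarith)]
      nlinarith
    · rw [← mul_div_assoc, div_le_iff₀ (by linarith)]
      nlinarith

section OrthonormalFrame

variable {n : ℕ} (M : Matrix (Fin n) (Fin n) ℝ) (e : Fin n → Fin n → ℝ)

/-- Matrix of the bilinear form of `M` in the frame `e`. -/
lemma frame_entry (i j : Fin n) :
    M.mulVec (e i) ⬝ᵥ e j = (Matrix.of e * Mᵀ * (Matrix.of e)ᵀ) i j := by
  rw [Matrix.mul_apply, dotProduct]
  refine Finset.sum_congr rfl fun k _ => ?_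
  rw [Matrix.mul_apply, Matrix.transpose_apply, Matrix.of_apply, Matrix.mulVec, dotProduct]
  congr 1
  exact Finset.sum_congr rfl fun l _ => by
    rw [Matrix.transpose_apply, Matrix.of_apply, mul_comm]

variable {e}

lemma frame_mul_transpose
    (he : ∀ i j, e i ⬝ᵥ e j = if i = j then (1 : ℝ) else 0) :
    Matrix.of e * (Matrix.of e)ᵀ = 1 := by
  ext i j
  rw [Matrix.one_apply, ← he i j]
  rfl

/-- The trace may be computed in any orthonormal frame. -/
lemma frame_trace (he : ∀ i j, e i ⬝ᵥ e j = if i = j then (1 : ℝ) else 0) :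
    ∑ i, M.mulVec (e i) ⬝ᵥ e i = M.trace := by
  have h := mul_eq_one_comm.1 (frame_mul_transpose he)
  simp only [frame_entry]
  change (Matrix.of e * Mᵀ * (Matrix.of e)ᵀ).trace = _
  rw [Matrix.trace_mul_comm, ← Matrix.mul_assoc, h, Matrix.one_mul, Matrix.trace_transpose]

/-- Parseval's identity in an orthonormal frame. -/
lemma frame_parseval (he : ∀ i j, e i ⬝ᵥ e j = if i = j then (1 : ℝ) else 0)
    (v : Fin n → ℝ) : ∑ j, (v ⬝ᵥ e j) ^ 2 = v ⬝ᵥ v := by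
  have h := mul_eq_one_comm.1 (frame_mul_transpose he)
  have h1 : ∀ j, v ⬝ᵥ e j = (Matrix.of e).mulVec v j := fun j => dotProduct_comm _ _
  calc ∑ j, (v ⬝ᵥ e j) ^ 2 = (Matrix.of e).mulVec v ⬝ᵥ (Matrix.of e).mulVec v := by
        simp only [h1, sq]
        rfl
    _ = v ⬝ᵥ v := by
        rw [Matrix.dotProduct_mulVec, Matrix.vecMul_mulVec, h, Matrix.vecMul_one]

/-- The squared Frobenius norm may be computed in any orthonormal frame. -/
lemma frame_sq_norm (he : ∀ i j, e i ⬝ᵥ e j = if i = j then (1 : ℝ) else 0) :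
    ∑ i, ∑ j, (M.mulVec (e i) ⬝ᵥ e j) ^ 2 = ∑ i, ∑ j, M i j ^ 2 := by
  simp only [frame_parseval he]
  have h1 : ∀ i, M.mulVec (e i) ⬝ᵥ M.mulVec (e i) = ∑ k, (M k ⬝ᵥ e i) ^ 2 := fun i => by
    simp only [dotProduct, Matrix.mulVec, sq]
  simp only [h1]
  rw [Finset.sum_comm]
  simp only [frame_parseval he]
  simp only [dotProduct, sq]

end OrthonormalFrame

theorem stmt_15 (n p : ℕ) (hn : 4 ≤ n) (hp : 1 ≤ p)
    (Hm : Fin p → Matrix (Fin n) (Fin n) ℝ) (hsym : ∀ α, (Hm α).IsSymm)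
    (c : ℝ) (hc : 0 ≤ c)
    (hR : scalarCurv n p Hm c > (n : ℝ) * ((n : ℝ) - 2) * (c + meanCurvSq n p Hm))
    (hRic : ∀ u : Fin n → ℝ, u ⬝ᵥ u = 1 →
      ricci n p Hm c u ≥
        ((n : ℝ) - 2 - 2 * (Real.sign ((n : ℝ) - 4) * ((-1 : ℝ) ^ n + 3)) / (2 * (n : ℝ) - Real.sign ((n : ℝ) - 4) * ((-1 : ℝ) ^ n + 3)))
          * (c + meanCurvSq n p Hm)) :
    ∀ q : ℕ, 1 ≤ q → 2 * q ≤ n →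
      ∀ e : Fin n → Fin n → ℝ, (∀ i j, e i ⬝ᵥ e j = if i = j then (1 : ℝ) else 0) →
        ∑ k ∈ Finset.univ.filter (fun k : Fin n => q ≤ (k : ℕ)),
            ∑ i ∈ Finset.univ.filter (fun i : Fin n => (i : ℕ) < q),
              (2 * sffInner n p Hm (e i) (e k) (e i) (e k)
                - sffInner n p Hm (e i) (e i) (e k) (e k))
          < (q : ℝ) * ((n : ℝ) - q) * c := by
  intro q hq hqn e he
  set I : Finset (Fin n) := Finset.univ.filter (fun i : Fin n => (i : ℕ) < q) with hI
  set J : Finset (Fin n) := Finset.univ.filter (fun k : Fin n => q ≤ (k : ℕ)) with hJ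
  have hnpos : (n : ℝ) ≠ 0 := by
    have : n ≠ 0 := by omega
    exact_mod_cast this
  have hcI : (I.card : ℝ) = q := by
    rw [hI, Fin.card_filter_val_lt, min_eq_right (by omega)]
  have hcJ : (J.card : ℝ) = n - q := by
    have h := sum_split_lt (n := n) q (fun _ => (1 : ℝ))
    rw [← hI, ← hJ] at h
    simp only [Finset.sum_const, nsmul_eq_mul, mul_one, Finset.card_univ, Fintype.card_fin] at h
    linarith
  obtain ⟨W, hW⟩ : ∃ W : Fin p → Fin n → Fin n → ℝ,
      ∀ α i j, (Hm α).mulVec (e i) ⬝ᵥ e j = W α i j := ⟨_, fun _ _ _ => rfl⟩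
  have hWs : ∀ α i j, W α i j = W α j i := fun α i j => by
    rw [← hW, ← hW, dotProduct_comm, Matrix.dotProduct_mulVec, ← Matrix.mulVec_transpose,
      (hsym α).eq]
  obtain ⟨t, ht⟩ : ∃ t : Fin p → ℝ, ∀ α, (Hm α).trace / n = t α := ⟨_, fun _ => rfl⟩
  have htr : ∀ α, (Hm α).trace = n * t α := fun α => by rw [← ht]; field_simp
  have hsplit : ∀ f : Fin n → ℝ, ∑ i, f i = ∑ i ∈ I, f i + ∑ i ∈ J, f i := sum_split_lt q
  have htrJ : ∀ α, ∑ k ∈ J, W α k k = n * t α - ∑ i ∈ I, W α i i := fun α => by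
    have h := frame_trace (Hm α) he
    simp only [hW] at h
    rw [hsplit, htr] at h
    linarith
  have hIJ : ∀ α, ∑ k ∈ J, ∑ i ∈ I, W α k i ^ 2 = ∑ i ∈ I, ∑ k ∈ J, W α i k ^ 2 := fun α => by
    rw [Finset.sum_comm]
    exact Finset.sum_congr rfl fun i _ => Finset.sum_congr rfl fun k _ => by rw [hWs]
  have hH : meanCurvSq n p Hm = ∑ α, t α ^ 2 := by simp only [meanCurvSq, ht]
  have hnorm : sqNormSff n p Hm = ∑ α, ∑ i ∈ I, ∑ j ∈ I, W α i j ^ 2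
      + ∑ α, ∑ i ∈ J, ∑ j ∈ J, W α i j ^ 2 + 2 * ∑ α, ∑ i ∈ I, ∑ k ∈ J, W α i k ^ 2 := by
    rw [sqNormSff, Finset.mul_sum, ← Finset.sum_add_distrib, ← Finset.sum_add_distrib]
    refine Finset.sum_congr rfl fun α _ => ?_
    rw [← frame_sq_norm (Hm α) he]
    simp only [hW, hsplit, Finset.sum_add_distrib, hIJ]
    ring
  obtain ⟨hD, hDone⟩ := pinching_bounds hn hq rfl
  have hLS : ∑ k ∈ J, ∑ i ∈ I, (2 * sffInner n p Hm (e i) (e k) (e i) (e k)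
      - sffInner n p Hm (e i) (e i) (e k) (e k))
      = 2 * ∑ α, ∑ i ∈ I, ∑ k ∈ J, W α i k ^ 2
        - (n * ∑ α, t α * ∑ i ∈ I, W α i i - ∑ α, (∑ i ∈ I, W α i i) ^ 2) := by
    have h1 : ∀ α, n * (t α * ∑ i ∈ I, W α i i) - (∑ i ∈ I, W α i i) ^ 2
        = ∑ i ∈ I, ∑ k ∈ J, W α i i * W α k k := fun α => by
      rw [← Finset.sum_mul_sum, htrJ]; ring
    rw [Finset.mul_sum, Finset.mul_sum, ← Finset.sum_sub_distrib, ← Finset.sum_sub_distrib,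
      Finset.sum_comm]
    simp only [h1]
    simp only [sffInner, sff, hW, Finset.mul_sum, ← Finset.sum_sub_distrib]
    conv_rhs => rw [Finset.sum_comm]
    refine Finset.sum_congr rfl fun i _ => ?_
    conv_rhs => rw [Finset.sum_comm]
    simp only [sq]
  rw [hLS]
  have hRicSum := Finset.sum_le_sum fun i (_ : i ∈ I) => hRic (e i) (by simp [he])
  simp only [ricci, ← frame_parseval he, hW, htr, hH, Finset.sum_const, nsmul_eq_mul, hcI,
    Finset.sum_add_distrib] at hRicSum
  have hRicI : ∑ i ∈ I, ∑ α, (n * t α * W α i i - ∑ j, W α i j ^ 2)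
      = n * ∑ α, t α * ∑ i ∈ I, W α i i
        - (∑ α, ∑ i ∈ I, ∑ j ∈ I, W α i j ^ 2 + ∑ α, ∑ i ∈ I, ∑ k ∈ J, W α i k ^ 2) := by
    rw [Finset.sum_comm, Finset.mul_sum, ← Finset.sum_add_distrib, ← Finset.sum_sub_distrib]
    refine Finset.sum_congr rfl fun α _ => ?_
    simp only [hsplit, Finset.sum_sub_distrib, Finset.sum_add_distrib, ← Finset.mul_sum]
    ring
  rw [hRicI] at hRicSum
  rw [scalarCurv, hnorm, hH] at hR
  refine block_bound (Q := ∑ α, ∑ i ∈ J, ∑ j ∈ J, W α i j ^ 2) (Z := ∑ α, t α ^ 2)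
    (by exact_mod_cast hn) ?_ (by exact_mod_cast hqn) ?_ ?_ ?_ ?_ hR ?_ hD hDone
  · rcases hq.eq_or_lt with h | h
    · exact Or.inl (by exact_mod_cast h.symm)
    · exact Or.inr (by exact_mod_cast h)
  · have : 0 ≤ ∑ α, (∑ i ∈ I, W α i i - q * t α) ^ 2 := by positivity
    convert this using 1
    rw [Finset.mul_sum, Finset.mul_sum, ← Finset.sum_sub_distrib, ← Finset.sum_add_distrib]
    exact Finset.sum_congr rfl fun α _ => by ring
  · positivity
  · rw [Finset.mul_sum]
    refine Finset.sum_le_sum fun α _ => ?_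
    simpa only [hcI] using sq_sum_diag_le I (W α)
  · have : ∑ α, (n * t α - ∑ i ∈ I, W α i i) ^ 2
        ≤ (n - q) * ∑ α, ∑ i ∈ J, ∑ j ∈ J, W α i j ^ 2 := by
      rw [Finset.mul_sum]
      refine Finset.sum_le_sum fun α _ => ?_
      simpa only [hcJ, htrJ] using sq_sum_diag_le J (W α)
    refine le_of_eq_of_le ?_ this
    rw [Finset.mul_sum, Finset.mul_sum, ← Finset.sum_sub_distrib, ← Finset.sum_add_distrib]
    exact Finset.sum_congr rfl fun α _ => by ring
  · refine le_of_eq_of_le ?_ hRicSum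
    ring
end
end
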